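/- arXiv:1509.08956 — 3 statements merged into one kernel-verified Lean document; each statement's English description precedes it below -/
import Mathlib

section
/- Let V be a nonzero finite-dimensional F-vector space, and let x, y, z ∈ End(V) with y invertible satisfy q x y − q⁻¹ y x = (q − q⁻¹)·1, q y z − q⁻¹ z y = (q − q⁻¹)·1, q z x − q⁻¹ x z = (q − q⁻¹)·1. Assume n_z := q(1 − x y)/(q − q⁻¹) is nilpotent. Then (y + z) ∘ exp_q(n_z) = exp_q(n_z) ∘ (x + z). -/
namespace Lusztig

variable (F : Type*) [Field F] (q : F)



/-- The q-integer [n]_q = (qⁿ − q⁻ⁿ)/(q − q⁻¹). -/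
noncomputable def qInt (n : ℤ) : F := (q ^ n - q ^ (-n)) / (q - q⁻¹)

/-- The q-factorial [n]!_q = [n]_q [n−1]_q ⋯ [1]_q, with [0]!_q = 1. -/
noncomputable def qFact (n : ℕ) : F := ∏ i ∈ Finset.range n, qInt F q ((i : ℤ) + 1)

/-- The q-exponential exp_q(φ) = Σ_{i≥0} q^{binom(i,2)} φ^i / [i]!_q of a nilpotent
endomorphism φ of a finite-dimensional space.  Since the nilpotency index of φ is at most
`finrank F V`, the series may be truncated at `finrank F V + 1` terms. -/
noncomputable def expq {V : Type*} [AddCommGroup V] [Module F V] (φ : Module.End F V) :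
    Module.End F V :=
  ∑ i ∈ Finset.range (Module.finrank F V + 1), (q ^ (i.choose 2) / qFact F q i) • φ ^ i

/-- The inverse of the q-exponential: exp_{q⁻¹}(−φ) = Σ_{i≥0} (−1)^i q^{−binom(i,2)} φ^i / [i]!_q. -/
noncomputable def expqInv {V : Type*} [AddCommGroup V] [Module F V] (φ : Module.End F V) :
    Module.End F V :=
  ∑ i ∈ Finset.range (Module.finrank F V + 1),
    (((-1 : F) ^ i * (q ^ (i.choose 2))⁻¹) / qFact F q i) • φ ^ i

/-- The q-exponential for square matrices (truncated at n + 1 terms, which is enough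
for nilpotent matrices). -/
noncomputable def expqM {n : ℕ} (φ : Matrix (Fin n) (Fin n) F) : Matrix (Fin n) (Fin n) F :=
  ∑ i ∈ Finset.range (n + 1), (q ^ (i.choose 2) / qFact F q i) • φ ^ i


theorem qsq_ne (hq : q ≠ 0) (hroot : ∀ n : ℕ, 0 < n → q ^ n ≠ 1) : q - q⁻¹ ≠ 0 := by
  intro h
  apply hroot 2 (by norm_num)
  field_simp at h
  linear_combination h

theorem qInt_succ_eq (hq : q ≠ 0) (k : ℕ) :
    qInt F q ((k : ℤ) + 1) = (q ^ (k + 1) - (q ^ (k + 1))⁻¹) / (q - q⁻¹) := by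
  unfold qInt
  rw [zpow_neg]
  norm_cast

theorem qInt_succ_ne (hq : q ≠ 0) (hroot : ∀ n : ℕ, 0 < n → q ^ n ≠ 1) (k : ℕ) :
    qInt F q ((k : ℤ) + 1) ≠ 0 := by
  rw [qInt_succ_eq F q hq]
  refine div_ne_zero ?_ (qsq_ne F q hq hroot)
  intro h
  apply hroot ((k + 1) * 2) (by omega)
  have h0 : q ^ (k + 1) ≠ 0 := pow_ne_zero _ hq
  rw [pow_mul]
  generalize q ^ (k + 1) = u at *
  field_simp at h
  linear_combination h

theorem coef_step (hq : q ≠ 0) (hroot : ∀ n : ℕ, 0 < n → q ^ n ≠ 1) (k : ℕ) :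
    (q ^ ((k + 1).choose 2) / qFact F q (k + 1)) * ((q ^ k)⁻¹ * qInt F q ((k : ℤ) + 1))
      = q ^ (k.choose 2) / qFact F q k := by
  have h1 := qInt_succ_ne F q hq hroot k
  have h2 : qFact F q k ≠ 0 := Finset.prod_ne_zero_iff.mpr
    (fun i _ => qInt_succ_ne F q hq hroot i)
  have h3 : qFact F q (k + 1) = qFact F q k * qInt F q ((k : ℤ) + 1) :=
    Finset.prod_range_succ _ _
  have h4 : (k + 1).choose 2 = k + k.choose 2 := by
    rw [Nat.choose_succ_succ' k 1, Nat.choose_one_right]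
  rw [h3, h4, pow_add]
  field_simp

theorem g_step1 (hq : q ≠ 0) (hroot : ∀ n : ℕ, 0 < n → q ^ n ≠ 1) (k : ℕ) :
    (q ^ (k + 1))⁻¹ * qInt F q (((k + 1 : ℕ) : ℤ) + 1)
      = 1 + ((q ^ k)⁻¹ * qInt F q ((k : ℤ) + 1)) * (q⁻¹ * q⁻¹) := by
  have h := qsq_ne F q hq hroot
  rw [qInt_succ_eq F q hq, qInt_succ_eq F q hq]
  have h0 : q ^ k ≠ 0 := pow_ne_zero _ hq
  simp only [pow_succ]
  generalize q ^ k = u at *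
  have h' : q ^ 2 - 1 ≠ 0 := by
    intro h2; apply h; field_simp; linear_combination h2
  field_simp
  ring

theorem g_step2 (hq : q ≠ 0) (hroot : ∀ n : ℕ, 0 < n → q ^ n ≠ 1) (k : ℕ) :
    (q ^ (k + 1))⁻¹ * qInt F q (((k + 1 : ℕ) : ℤ) + 1)
      = ((q⁻¹ * q⁻¹) ^ (k + 1)) + ((q ^ k)⁻¹ * qInt F q ((k : ℤ) + 1)) := by
  have h := qsq_ne F q hq hroot
  rw [qInt_succ_eq F q hq, qInt_succ_eq F q hq]
  have h0 : q ^ k ≠ 0 := pow_ne_zero _ hq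
  simp only [pow_succ, mul_pow, inv_pow]
  generalize q ^ k = u at *
  have h' : q ^ 2 - 1 ≠ 0 := by
    intro h2; apply h; field_simp; linear_combination h2
  field_simp
  ring

theorem comm_pow {A : Type*} [Ring A] [Algebra F A]
    (hq : q ≠ 0) (hroot : ∀ n : ℕ, 0 < n → q ^ n ≠ 1) (x y z n : A)
    (hx : x * n = (q⁻¹ * q⁻¹) • (n * x)) (hy : n * y = (q⁻¹ * q⁻¹) • (y * n))
    (hz : z * n = n * z + x - y) (k : ℕ) :
    z * n ^ (k + 1) = n ^ (k + 1) * z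
      + ((q ^ k)⁻¹ * qInt F q ((k : ℤ) + 1)) • (n ^ k * x - y * n ^ k) := by
  have hyk : ∀ k : ℕ, n ^ k * y = ((q⁻¹ * q⁻¹) ^ k) • (y * n ^ k) := by
    intro k
    induction k with
    | zero => simp
    | succ k ih =>
      rw [pow_succ, mul_assoc, hy, mul_smul_comm, ← mul_assoc, ih, smul_mul_assoc, smul_smul,
        mul_assoc y, pow_succ' (q⁻¹ * q⁻¹)]
  induction k with
  | zero =>
    have : qInt F q 1 = 1 := by
      have := qInt_succ_eq F q hq 0
      simp at this
      rw [this, div_self (qsq_ne F q hq hroot)]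
    simp [this, hz, add_sub_assoc]
  | succ k ih =>
    have e : z * n ^ (k + 1 + 1) = n ^ (k + 1) * (z * n) +
        ((q ^ k)⁻¹ * qInt F q ((k : ℤ) + 1)) • (n ^ k * (x * n) - y * n ^ (k + 1)) := by
      rw [pow_succ n (k + 1), ← mul_assoc, ih, add_mul, smul_mul_assoc, sub_mul, pow_succ n k]
      simp only [mul_assoc]
    rw [e, hz, hx, smul_sub, smul_sub]
    nth_rewrite 1 [g_step1 F q hq hroot]
    rw [g_step2 F q hq hroot, mul_sub, mul_add, hyk (k + 1), mul_smul_comm, smul_smul,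
      add_smul, add_smul, one_smul, pow_succ n (k + 1), ← mul_assoc (n ^ k), ← pow_succ,
      ← mul_assoc (n ^ (k + 1))]
    abel

/-- (y + z) ∘ exp_q(n_z) = exp_q(n_z) ∘ (x + z). -/
theorem stmt11 (hq : q ≠ 0) (hroot : ∀ n : ℕ, 0 < n → q ^ n ≠ 1)
    (V : Type*) [AddCommGroup V] [Module F V] [FiniteDimensional F V] [Nontrivial V]
    (x y z : Module.End F V) (hy : IsUnit y)
    (hxy : q • (x * y) - q⁻¹ • (y * x) = (q - q⁻¹) • (1 : Module.End F V))
    (hyz : q • (y * z) - q⁻¹ • (z * y) = (q - q⁻¹) • (1 : Module.End F V))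
    (hzx : q • (z * x) - q⁻¹ • (x * z) = (q - q⁻¹) • (1 : Module.End F V))
    (nz : Module.End F V) (hnz : nz = (q / (q - q⁻¹)) • (1 - x * y))
    (hnil : IsNilpotent nz) :
    (y + z) * expq F q nz = expq F q nz * (x + z) := by
  have hc := qsq_ne F q hq hroot
  have hc' : q ^ 2 - 1 ≠ 0 := sub_ne_zero.mpr (hroot 2 (by norm_num))
  have hpow : nz ^ Module.finrank F V = 0 := by
    have h1 := (LinearMap.charpoly_nilpotent_tfae nz).out 0 1
    have h2 := h1.mp hnil
    have h3 := LinearMap.aeval_self_charpoly nz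
    rw [h2] at h3
    simpa using h3
  have exy : x * y = 1 - ((q - q⁻¹) * q⁻¹) • nz := by
    rw [hnz, smul_smul, show (q - q⁻¹) * q⁻¹ * (q / (q - q⁻¹)) = 1 by field_simp, one_smul]
    abel
  have eyx : y * x = 1 - ((q - q⁻¹) * q) • nz := by
    have h : y * x = q • (q • (x * y)) - q • ((q - q⁻¹) • (1 : Module.End F V)) := by
      rw [← hxy, smul_sub, smul_smul q q⁻¹, mul_inv_cancel₀ hq, one_smul]
      abel
    rw [h, exy]
    match_scalars <;> field_simp <;> ring
  have ezy : z * y = (q * q) • (y * z) - (q * (q - q⁻¹)) • (1 : Module.End F V) := by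
    rw [mul_smul q (q - q⁻¹), ← hyz, smul_sub, smul_smul, smul_smul, mul_inv_cancel₀ hq, one_smul]
    abel
  have ezx : z * x = (q⁻¹ * q⁻¹) • (x * z) + (q⁻¹ * (q - q⁻¹)) • (1 : Module.End F V) := by
    rw [mul_smul q⁻¹ (q - q⁻¹), ← hzx, smul_sub, smul_smul, smul_smul, inv_mul_cancel₀ hq,
      one_smul]
    abel
  have hx : x * nz = (q⁻¹ * q⁻¹) • (nz * x) := by
    have h := mul_assoc x y x
    rw [exy, eyx, sub_mul, mul_sub, one_mul, mul_one, smul_mul_assoc, mul_smul_comm] at h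
    have h := sub_right_injective h
    have h2 := congrArg (fun t => ((q - q⁻¹) * q)⁻¹ • t) h
    simp only [smul_smul] at h2
    rw [inv_mul_cancel₀ (mul_ne_zero hc hq), one_smul] at h2
    rw [← h2]
    congr 1
    field_simp
  have hy' : nz * y = (q⁻¹ * q⁻¹) • (y * nz) := by
    have h := mul_assoc y x y
    rw [exy, eyx, sub_mul, mul_sub, one_mul, mul_one, smul_mul_assoc, mul_smul_comm] at h
    have h := sub_right_injective h
    have h2 := congrArg (fun t => ((q - q⁻¹) * q)⁻¹ • t) h
    simp only [smul_smul] at h2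
    rw [inv_mul_cancel₀ (mul_ne_zero hc hq), one_smul] at h2
    rw [h2]
    congr 1
    field_simp
  have hz : z * nz = nz * z + x - y := by
    have h : z * (x * y) = x * y * z - (q⁻¹ * (q - q⁻¹)) • x + (q⁻¹ * (q - q⁻¹)) • y := by
      rw [← mul_assoc, ezx, add_mul, smul_mul_assoc, smul_mul_assoc, one_mul, mul_assoc x z y, ezy,
        mul_sub, mul_smul_comm, mul_smul_comm, mul_one, mul_assoc]
      match_scalars <;> field_simp
    rw [hnz, mul_smul_comm, mul_sub, h, smul_mul_assoc, sub_mul, mul_one, one_mul]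
    match_scalars <;> field_simp
  have key := comm_pow F q hq hroot x y z nz hx hy' hz
  have e1 : z * expq F q nz - expq F q nz * z = expq F q nz * x - y * expq F q nz := by
    unfold expq
    rw [Finset.mul_sum, Finset.sum_mul, ← Finset.sum_sub_distrib, Finset.sum_range_succ',
      Finset.sum_mul, Finset.mul_sum, ← Finset.sum_sub_distrib, Finset.sum_range_succ, hpow]
    simp only [pow_zero, smul_zero, zero_mul, mul_zero, sub_zero, add_zero, smul_mul_assoc,
      mul_smul_comm, one_mul, mul_one, sub_self]
    refine Finset.sum_congr rfl fun k _ => ?_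
    rw [key k, ← smul_sub, add_sub_cancel_left, smul_smul, coef_step F q hq hroot, smul_sub]
  rw [add_mul, mul_add]
  rw [sub_eq_sub_iff_add_eq_add] at e1
  rw [add_comm, e1]

end Lusztig
end

section
/- Let V be a nonzero finite-dimensional F-vector space, and let x, y, z ∈ End(V) with y invertible satisfy q x y − q⁻¹ y x = (q − q⁻¹)·1, q y z − q⁻¹ z y = (q − q⁻¹)·1, q z x − q⁻¹ x z = (q − q⁻¹)·1. Assume n_z := q(1 − x y)/(q − q⁻¹) is nilpotent and x is invertible. Then exp_q(n_z)⁻¹ ∘ z ∘ exp_q(n_z) = x − x⁻¹ + z. -/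
namespace Lusztig

variable (F : Type*) [Field F] (q : F)



theorem aux_qsq (F : Type*) [Field F] (q : F) (hq : q ≠ 0) (hroot : ∀ n : ℕ, 0 < n → q ^ n ≠ 1)
    (i : ℕ) : q ^ (2 * (i + 1)) - 1 ≠ 0 := sub_ne_zero.mpr (hroot _ (by omega))

theorem aux_sub (F : Type*) [Field F] (q : F) (hq : q ≠ 0) (hroot : ∀ n : ℕ, 0 < n → q ^ n ≠ 1) :
    q - q⁻¹ ≠ 0 := by
  have h := hroot 2 (by norm_num)
  intro h0
  apply h
  have : q * (q - q⁻¹) = 0 := by rw [h0, mul_zero]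
  rw [mul_sub, mul_inv_cancel₀ hq] at this
  linear_combination this

theorem aux_qInt (F : Type*) [Field F] (q : F) (hq : q ≠ 0) (hroot : ∀ n : ℕ, 0 < n → q ^ n ≠ 1)
    (i : ℕ) : q ^ (2 * (i + 1)) - 1 = qInt F q ((i : ℤ) + 1) * (q ^ i * (q ^ 2 - 1)) := by
  have h1 := aux_sub F q hq hroot
  have h2 : qInt F q ((i : ℤ) + 1) * (q - q⁻¹) = q ^ (i + 1) - (q ^ (i + 1))⁻¹ := by
    unfold qInt
    rw [div_mul_cancel₀ _ h1, zpow_neg]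
    norm_cast
  have h3 : q ^ 2 - 1 = q * (q - q⁻¹) := by field_simp
  rw [h3]
  have : qInt F q ((i : ℤ) + 1) * (q ^ i * (q * (q - q⁻¹)))
      = q ^ (i + 1) * (qInt F q ((i : ℤ) + 1) * (q - q⁻¹)) := by ring
  rw [this, h2, mul_sub, mul_inv_cancel₀ (pow_ne_zero _ hq)]
  ring

theorem aux_qInt_ne (F : Type*) [Field F] (q : F) (hq : q ≠ 0) (hroot : ∀ n : ℕ, 0 < n → q ^ n ≠ 1)
    (i : ℕ) : qInt F q ((i : ℤ) + 1) ≠ 0 := by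
  intro h
  have := aux_qInt F q hq hroot i
  rw [h, zero_mul] at this
  exact aux_qsq F q hq hroot i this

theorem aux_fact_ne (F : Type*) [Field F] (q : F) (hq : q ≠ 0) (hroot : ∀ n : ℕ, 0 < n → q ^ n ≠ 1)
    (i : ℕ) : qFact F q i ≠ 0 :=
  Finset.prod_ne_zero_iff.mpr fun j _ => aux_qInt_ne F q hq hroot j

theorem aux_fact_succ (F : Type*) [Field F] (q : F) (i : ℕ) :
    qFact F q (i + 1) = qFact F q i * qInt F q ((i : ℤ) + 1) := by
  unfold qFact
  rw [Finset.prod_range_succ]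

theorem aux_choose (i : ℕ) : (i + 1).choose 2 = i + i.choose 2 := by
  rw [Nat.choose_succ_succ' i 1, Nat.choose_one_right]

theorem aux_c (F : Type*) [Field F] (q : F) (hq : q ≠ 0) (hroot : ∀ n : ℕ, 0 < n → q ^ n ≠ 1)
    (i : ℕ) : (q ^ ((i + 1).choose 2) / qFact F q (i + 1)) * (q ^ (2 * (i + 1)) - 1)
      = (q ^ 2 - 1) * q ^ (2 * i) * (q ^ (i.choose 2) / qFact F q i) := by
  have h1 := aux_fact_ne F q hq hroot i
  have h2 := aux_qInt_ne F q hq hroot i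
  rw [aux_qInt F q hq hroot, aux_fact_succ, aux_choose, pow_add, two_mul, pow_add]
  field_simp

theorem aux_d (F : Type*) [Field F] (q : F) (hq : q ≠ 0) (hroot : ∀ n : ℕ, 0 < n → q ^ n ≠ 1)
    (i : ℕ) : (((-1 : F) ^ (i + 1) * (q ^ ((i + 1).choose 2))⁻¹) / qFact F q (i + 1))
        * (q ^ (2 * (i + 1)) - 1)
      = - (q ^ 2 - 1) * (((-1 : F) ^ i * (q ^ (i.choose 2))⁻¹) / qFact F q i) := by
  have h1 := aux_fact_ne F q hq hroot i
  have h2 := aux_qInt_ne F q hq hroot i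
  rw [aux_qInt F q hq hroot, aux_fact_succ, aux_choose, pow_add q, pow_succ (-1 : F)]
  field_simp

open PowerSeries in
theorem aux_ps (F : Type*) [Field F] (q : F) (hroot : ∀ n : ℕ, 0 < n → q ^ n ≠ 1)
    (c d : ℕ → F) (hc0 : c 0 = 1) (hd0 : d 0 = 1)
    (hc : ∀ i, c (i + 1) * (q ^ (2 * (i + 1)) - 1) = (q ^ 2 - 1) * q ^ (2 * i) * c i)
    (hd : ∀ i, d (i + 1) * (q ^ (2 * (i + 1)) - 1) = - (q ^ 2 - 1) * d i) :
    PowerSeries.mk d * PowerSeries.mk c = 1 := by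
  have hC : rescale (q ^ 2) (PowerSeries.mk c) * (1 - C (q ^ 2 - 1) * X) = PowerSeries.mk c := by
    ext m
    rw [mul_sub, mul_one, mul_left_comm, ← mul_assoc]
    rcases m with _ | m
    · rw [map_sub, coeff_zero_mul_X]
      simp only [coeff_rescale, coeff_mk]
      simp
    · rw [map_sub, coeff_succ_mul_X, coeff_C_mul]
      simp only [coeff_rescale, coeff_mk, ← pow_mul]
      linear_combination hc m
  have hD : PowerSeries.mk d * (1 - C (q ^ 2 - 1) * X) = rescale (q ^ 2) (PowerSeries.mk d) := by
    ext m
    rw [mul_sub, mul_one, mul_left_comm, ← mul_assoc]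
    rcases m with _ | m
    · rw [map_sub, coeff_zero_mul_X]
      simp only [coeff_rescale, coeff_mk]
      simp
    · rw [map_sub, coeff_succ_mul_X, coeff_C_mul]
      simp only [coeff_rescale, coeff_mk, ← pow_mul]
      linear_combination - hd m
  have hP : rescale (q ^ 2) (PowerSeries.mk d * PowerSeries.mk c)
      = PowerSeries.mk d * PowerSeries.mk c := by
    rw [map_mul, ← hD]
    conv_rhs => rw [← hC]
    ring
  ext m
  rcases m with _ | m
  · simp [hc0, hd0]
  · have := congrArg (coeff (m + 1)) hP
    rw [coeff_rescale, ← pow_mul] at this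
    have h2 : q ^ (2 * (m + 1)) - 1 ≠ 0 := sub_ne_zero.mpr (hroot _ (by omega))
    rw [coeff_one, if_neg (by omega)]
    apply (mul_eq_zero.mp (_ : (q ^ (2 * (m + 1)) - 1) * _ = 0)).resolve_left h2
    rw [sub_mul, this, one_mul, sub_self]

theorem aux_trunc (F : Type*) [Field F] {A : Type*} [Ring A] [Algebra F A] (c d : ℕ → F)
    (h : PowerSeries.mk d * PowerSeries.mk c = 1) (N : ℕ) (n : A) (hn : n ^ (N + 1) = 0) :
    (∑ i ∈ Finset.range (N + 1), d i • n ^ i) * (∑ i ∈ Finset.range (N + 1), c i • n ^ i) = 1 := by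
  have key : ∀ f : ℕ → F, Polynomial.aeval n (PowerSeries.trunc (N + 1) (PowerSeries.mk f))
      = ∑ i ∈ Finset.range (N + 1), f i • n ^ i := by
    intro f
    rw [Polynomial.aeval_eq_sum_range' (PowerSeries.natDegree_trunc_lt _ N)]
    refine Finset.sum_congr rfl fun i hi => ?_
    rw [PowerSeries.coeff_trunc, if_pos (Finset.mem_range.mp hi), PowerSeries.coeff_mk]
  rw [← key, ← key, ← map_mul]
  have hdvd : (Polynomial.X : Polynomial F) ^ (N + 1) ∣
      PowerSeries.trunc (N + 1) (PowerSeries.mk d) * PowerSeries.trunc (N + 1) (PowerSeries.mk c)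
        - 1 := by
    rw [Polynomial.X_pow_dvd_iff]
    intro m hm
    rw [Polynomial.coeff_sub, sub_eq_zero]
    have h1 := PowerSeries.coeff_mul_eq_coeff_trunc_mul_trunc (PowerSeries.mk d)
      (PowerSeries.mk c) hm
    rw [h] at h1
    rw [← Polynomial.coeff_coe, Polynomial.coe_mul, ← h1, PowerSeries.coeff_one,
      Polynomial.coeff_one]
  obtain ⟨r, hr⟩ := hdvd
  rw [sub_eq_iff_eq_add.mp hr]
  simp [hn]

theorem aux_z (F : Type*) [Field F] {A : Type*} [Ring A] [Algebra F A] (q : F) (hq : q ≠ 0)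
    (hroot : ∀ n : ℕ, 0 < n → q ^ n ≠ 1)
    (x y z n : A) (hx : x * n = (q ^ 2)⁻¹ • (n * x)) (hy : y * n = q ^ 2 • (n * y))
    (hz : z * n = n * z + x - y) (i : ℕ) :
    z * n ^ (i + 1) = n ^ (i + 1) * z
      + ((q ^ (2 * (i + 1)) - 1) / ((q ^ 2 - 1) * q ^ (2 * i))) • (n ^ i * x)
      - ((q ^ (2 * (i + 1)) - 1) / (q ^ 2 - 1)) • (n ^ i * y) := by
  have h2 : q ^ 2 - 1 ≠ 0 := sub_ne_zero.mpr (hroot 2 (by omega))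
  induction i with
  | zero => simp [hz, h2]
  | succ i ih =>
    rw [pow_succ n (i + 1), ← mul_assoc, ih, sub_mul, add_mul, smul_mul_assoc, smul_mul_assoc,
      mul_assoc _ z, mul_assoc _ x, mul_assoc _ y, hx, hy, hz, mul_smul_comm, mul_smul_comm,
      ← mul_assoc _ n x, ← mul_assoc _ n y, ← pow_succ, mul_sub, mul_add, ← mul_assoc]
    have e1 : (q ^ (2 * (i + 1 + 1)) - 1) / ((q ^ 2 - 1) * q ^ (2 * (i + 1)))
      = 1 + (q ^ (2 * (i + 1)) - 1) / ((q ^ 2 - 1) * q ^ (2 * i)) * (q ^ 2)⁻¹ := by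
      field_simp
      ring
    have e2 : (q ^ (2 * (i + 1 + 1)) - 1) / (q ^ 2 - 1)
      = 1 + (q ^ (2 * (i + 1)) - 1) / (q ^ 2 - 1) * q ^ 2 := by
      field_simp
      ring
    rw [e1, e2]
    module

theorem aux_sum (F : Type*) [Field F] {A : Type*} [Ring A] [Algebra F A] (q : F) (hq : q ≠ 0)
    (hroot : ∀ n : ℕ, 0 < n → q ^ n ≠ 1) (c : ℕ → F)
    (hc : ∀ i, c (i + 1) * (q ^ (2 * (i + 1)) - 1) = (q ^ 2 - 1) * q ^ (2 * i) * c i)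
    (x y z n : A) (hx : x * n = (q ^ 2)⁻¹ • (n * x)) (hy : y * n = q ^ 2 • (n * y))
    (hz : z * n = n * z + x - y) (m : ℕ) :
    z * (∑ i ∈ Finset.range (m + 1), c i • n ^ i) = (∑ i ∈ Finset.range (m + 1), c i • n ^ i) * z
      + (∑ i ∈ Finset.range m, c i • n ^ i) * x
      - (∑ i ∈ Finset.range m, (q ^ (2 * i) * c i) • n ^ i) * y := by
  have h2 : q ^ 2 - 1 ≠ 0 := sub_ne_zero.mpr (hroot 2 (by omega))
  induction m with
  | zero => simp
  | succ m ih =>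
    rw [Finset.sum_range_succ _ (m + 1), mul_add, ih, Finset.sum_range_succ (fun i => c i • n ^ i) m,
      Finset.sum_range_succ (fun i => (q ^ (2 * i) * c i) • n ^ i) m, mul_smul_comm,
      aux_z F q hq hroot x y z n hx hy hz]
    have e1 : c m = c (m + 1) * ((q ^ (2 * (m + 1)) - 1) / ((q ^ 2 - 1) * q ^ (2 * m))) := by
      rw [← mul_div_assoc, hc]
      field_simp
    have e2 : q ^ (2 * m) * c m = c (m + 1) * ((q ^ (2 * (m + 1)) - 1) / (q ^ 2 - 1)) := by
      rw [← mul_div_assoc, hc]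
      field_simp
    have t1 : (c m • n ^ m) * x
        = c (m + 1) • ((q ^ (2 * (m + 1)) - 1) / ((q ^ 2 - 1) * q ^ (2 * m))) • (n ^ m * x) := by
      rw [smul_smul, ← e1, smul_mul_assoc]
    have t2 : ((q ^ (2 * m) * c m) • n ^ m) * y
        = c (m + 1) • ((q ^ (2 * (m + 1)) - 1) / (q ^ 2 - 1)) • (n ^ m * y) := by
      rw [smul_smul, ← e2, smul_mul_assoc]
    simp only [add_mul, smul_sub, smul_add]
    rw [t1, t2, smul_mul_assoc (c (m + 1)) (n ^ (m + 1)) z]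
    abel

theorem aux_sum2 (F : Type*) [Field F] {A : Type*} [Ring A] [Algebra F A] (q : F) (c : ℕ → F)
    (hc : ∀ i, c (i + 1) * (q ^ (2 * (i + 1)) - 1) = (q ^ 2 - 1) * q ^ (2 * i) * c i)
    (n : A) (m : ℕ) :
    (∑ i ∈ Finset.range (m + 1), (q ^ (2 * i) * c i) • n ^ i) * (1 - (q ^ 2 - 1) • n)
      = (∑ i ∈ Finset.range (m + 1), c i • n ^ i)
        - ((q ^ 2 - 1) * q ^ (2 * m) * c m) • n ^ (m + 1) := by
  induction m with
  | zero => simp [mul_sub, smul_smul, mul_comm]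
  | succ m ih =>
    rw [Finset.sum_range_succ, add_mul, ih, Finset.sum_range_succ (fun i => c i • n ^ i) (m + 1),
      ← hc, mul_sub (_ • n ^ (m + 1)), mul_one, mul_smul_comm, smul_mul_assoc, ← pow_succ]
    module

/-- exp_q(n_z)⁻¹ ∘ z ∘ exp_q(n_z) = x − x⁻¹ + z. -/
theorem stmt12 (hq : q ≠ 0) (hroot : ∀ n : ℕ, 0 < n → q ^ n ≠ 1)
    (V : Type*) [AddCommGroup V] [Module F V] [FiniteDimensional F V] [Nontrivial V]
    (x y z : Module.End F V) (hy : IsUnit y)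
    (hxy : q • (x * y) - q⁻¹ • (y * x) = (q - q⁻¹) • (1 : Module.End F V))
    (hyz : q • (y * z) - q⁻¹ • (z * y) = (q - q⁻¹) • (1 : Module.End F V))
    (hzx : q • (z * x) - q⁻¹ • (x * z) = (q - q⁻¹) • (1 : Module.End F V))
    (nz : Module.End F V) (hnz : nz = (q / (q - q⁻¹)) • (1 - x * y))
    (hnil : IsNilpotent nz) (hx : IsUnit x) :
    expqInv F q nz * z * expq F q nz = x - Ring.inverse x + z := by
  have hs := aux_sub F q hq hroot
  have hN : nz ^ Module.finrank F V = 0 := by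
    have := (LinearMap.isNilpotent_iff_charpoly nz).mp hnil
    have h := LinearMap.aeval_self_charpoly nz
    rw [this] at h
    simpa using h
  have h2 : q ^ 2 - 1 ≠ 0 := sub_ne_zero.mpr (hroot 2 (by omega))
  have hyx : y * x = q ^ 2 • (x * y) - (q ^ 2 - 1) • (1 : Module.End F V) := by
    have h := congrArg (fun t => q • t) hxy
    simp only [smul_sub, smul_smul, mul_inv_cancel₀ hq, one_smul, mul_sub] at h
    rw [sub_eq_iff_eq_add] at h
    rw [pow_two, h]
    module
  have hzy : z * y = q ^ 2 • (y * z) - (q ^ 2 - 1) • (1 : Module.End F V) := by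
    have h := congrArg (fun t => q • t) hyz
    simp only [smul_sub, smul_smul, mul_inv_cancel₀ hq, one_smul, mul_sub] at h
    rw [sub_eq_iff_eq_add] at h
    rw [pow_two, h]
    module
  have hzx' : z * x = (q ^ 2)⁻¹ • (x * z) + (1 - (q ^ 2)⁻¹) • (1 : Module.End F V) := by
    have h := congrArg (fun t => q⁻¹ • t) hzx
    simp only [smul_sub, smul_smul, inv_mul_cancel₀ hq, one_smul, mul_sub] at h
    rw [sub_eq_iff_eq_add] at h
    rw [h, pow_two, mul_inv]
    module
  have hq2 : q / (q - q⁻¹) = q ^ 2 / (q ^ 2 - 1) := by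
    rw [div_eq_div_iff hs h2]
    field_simp
  rw [hq2] at hnz
  have hxn : x * nz = (q ^ 2)⁻¹ • (nz * x) := by
    rw [hnz]
    simp only [mul_smul_comm, smul_mul_assoc, mul_sub, sub_mul, mul_one, one_mul, mul_assoc, hyx]
    simp only [smul_sub, mul_smul_comm, smul_smul, mul_one, mul_sub]
    match_scalars <;> field_simp <;> ring
  have hyn : y * nz = q ^ 2 • (nz * y) := by
    rw [hnz]
    simp only [mul_smul_comm, smul_mul_assoc, mul_sub, sub_mul, mul_one, one_mul, ← mul_assoc, hyx]
    simp only [smul_sub, mul_smul_comm, smul_mul_assoc, smul_smul, mul_one, one_mul, sub_mul]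
    match_scalars <;> field_simp <;> ring
  have hzn : z * nz = nz * z + x - y := by
    have e : z * (x * y) = x * y * z + ((q ^ 2)⁻¹ - 1) • x + (1 - (q ^ 2)⁻¹) • y := by
      rw [← mul_assoc, hzx', add_mul, smul_mul_assoc, mul_assoc x z y, hzy, mul_sub,
        mul_smul_comm, mul_smul_comm, mul_one, smul_mul_assoc, one_mul, ← mul_assoc]
      match_scalars <;> field_simp <;> ring
    rw [hnz, mul_smul_comm, mul_sub, mul_one, e, smul_mul_assoc, sub_mul, one_mul]
    match_scalars <;> field_simp <;> ring
  have hyx' : y * x = 1 - (q ^ 2 - 1) • nz := by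
    rw [hyx, hnz]
    match_scalars <;> field_simp <;> ring
  obtain ⟨u, rfl⟩ := hx
  rw [Ring.inverse_unit]
  have hc := aux_c F q hq hroot
  have hd := aux_d F q hq hroot
  have hps := aux_ps F q hroot (fun i => q ^ (i.choose 2) / qFact F q i)
    (fun i => ((-1 : F) ^ i * (q ^ (i.choose 2))⁻¹) / qFact F q i)
    (by simp [qFact]) (by simp [qFact]) hc hd
  have hinv : expqInv F q nz * expq F q nz = 1 :=
    aux_trunc F _ _ hps (Module.finrank F V) nz (by rw [pow_succ, hN, zero_mul])
  have hpos : 0 < Module.finrank F V := Module.finrank_pos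
  have hE : expq F q nz = ∑ i ∈ Finset.range (Module.finrank F V),
      (q ^ (i.choose 2) / qFact F q i) • nz ^ i := by
    unfold expq
    rw [Finset.sum_range_succ, hN, smul_zero, add_zero]
  have h1 := aux_sum F q hq hroot (fun i => q ^ (i.choose 2) / qFact F q i) hc
    (u : Module.End F V) y z nz hxn hyn hzn (Module.finrank F V)
  have h3 : (∑ i ∈ Finset.range (Module.finrank F V),
      (q ^ (2 * i) * (q ^ (i.choose 2) / qFact F q i)) • nz ^ i) * (y * u) = expq F q nz := by
    rw [hE, hyx']
    obtain ⟨k, hk⟩ := Nat.exists_eq_succ_of_ne_zero hpos.ne'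
    rw [hk] at hN ⊢
    have := aux_sum2 F q (fun i => q ^ (i.choose 2) / qFact F q i) hc nz k
    rw [hN, smul_zero, sub_zero] at this
    exact this
  have h4 : (∑ i ∈ Finset.range (Module.finrank F V),
      (q ^ (2 * i) * (q ^ (i.choose 2) / qFact F q i)) • nz ^ i) * y
        = expq F q nz * (↑u⁻¹ : Module.End F V) := by
    rw [← h3, mul_assoc, mul_assoc, Units.mul_inv, mul_one]
  have h5 : z * expq F q nz = expq F q nz * (u - (↑u⁻¹ : Module.End F V) + z) := by
    rw [mul_add, mul_sub, ← h4]
    refine Eq.trans h1 ?_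
    rw [hE, ← hE]
    change expq F q nz * z + _ - _ = _
    abel
  rw [mul_assoc, h5, ← mul_assoc, hinv, one_mul]

end Lusztig
end

section
/- Let V be a nonzero finite-dimensional F-vector space, and let x, y, z ∈ End(V) with y invertible satisfy q x y − q⁻¹ y x = (q − q⁻¹)·1, q y z − q⁻¹ z y = (q − q⁻¹)·1, q z x − q⁻¹ x z = (q − q⁻¹)·1. Assume n_z := q(1 − x y)/(q − q⁻¹) is nilpotent. Then exp_q(n_z)⁻¹ ∘ x ∘ exp_q(n_z) = x y x. -/
namespace Lusztig

variable (F : Type*) [Field F] (q : F)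



section helpers
open PowerSeries

theorem qInt_ne (hq : q ≠ 0) (hroot : ∀ n : ℕ, 0 < n → q ^ n ≠ 1) (i : ℕ) :
    qInt F q ((i : ℤ) + 1) ≠ 0 ∧ q - q⁻¹ ≠ 0 ∧
    (qInt F q ((i : ℤ) + 1)) * ((q - q⁻¹) * q ^ (i + 1)) = (q ^ (i + 1)) ^ 2 - 1 := by
  have h1 : q - q⁻¹ ≠ 0 := by
    intro h
    apply hroot 2 (by norm_num)
    have : q = q⁻¹ := sub_eq_zero.mp h
    rw [pow_two]; nth_rewrite 2 [this]; exact mul_inv_cancel₀ hq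
  have h3 : (qInt F q ((i : ℤ) + 1)) * ((q - q⁻¹) * q ^ (i + 1)) = (q ^ (i + 1)) ^ 2 - 1 := by
    unfold qInt
    have e : ((i : ℤ) + 1) = ((i + 1 : ℕ) : ℤ) := by push_cast; rfl
    rw [e, zpow_neg, zpow_natCast, ← mul_assoc, div_mul_cancel₀ _ h1, sub_mul,
      inv_mul_cancel₀ (pow_ne_zero _ hq), pow_two]
  refine ⟨?_, h1, h3⟩
  intro h
  rw [h, zero_mul, ← pow_mul] at h3
  exact hroot ((i + 1) * 2) (by positivity) (sub_eq_zero.mp h3.symm)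

theorem qFact_ne (hq : q ≠ 0) (hroot : ∀ n : ℕ, 0 < n → q ^ n ≠ 1) (i : ℕ) :
    qFact F q i ≠ 0 :=
  Finset.prod_ne_zero_iff.mpr fun j _ => (qInt_ne F q hq hroot j).1

theorem qFact_succ (i : ℕ) : qFact F q (i + 1) = qFact F q i * qInt F q ((i : ℤ) + 1) :=
  Finset.prod_range_succ _ _

noncomputable def eS : PowerSeries F := PowerSeries.mk fun i => q ^ (i.choose 2) / qFact F q i
noncomputable def gS : PowerSeries F :=
  PowerSeries.mk fun i => ((-1 : F) ^ i * (q ^ (i.choose 2))⁻¹) / qFact F q i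

theorem eS_eq (hq : q ≠ 0) (hroot : ∀ n : ℕ, 0 < n → q ^ n ≠ 1) :
    rescale ((q ^ 2)⁻¹) (eS F q) = eS F q * (1 - C (1 - (q ^ 2)⁻¹) * X) := by
  ext i
  rw [mul_sub, mul_one, ← mul_assoc, mul_comm (eS F q) (C _), mul_assoc]
  rcases i with _ | i
  · simp
  · rw [map_sub]
    simp only [coeff_rescale, coeff_C_mul, coeff_succ_mul_X, eS, coeff_mk]
    obtain ⟨h1, h2, h3⟩ := qInt_ne F q hq hroot i
    have hf := qFact_ne F q hq hroot i
    rw [qFact_succ, Nat.choose_succ_succ' i 1, Nat.choose_one_right, pow_add q]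
    have hp := pow_ne_zero i hq
    set K := qInt F q ((i : ℤ) + 1)
    set A := qFact F q i
    rw [pow_succ q i] at h3
    have e1 : ((q ^ 2)⁻¹) ^ (i + 1) = ((q ^ i * q) ^ 2)⁻¹ := by
      rw [inv_pow]; congr 1; ring
    rw [e1]
    generalize q ^ i = u at *
    generalize q ^ (i.choose 2) = w at *
    field_simp at h3 ⊢
    linear_combination w * h3

theorem gS_eq (hq : q ≠ 0) (hroot : ∀ n : ℕ, 0 < n → q ^ n ≠ 1) :
    gS F q = (1 - C (1 - (q ^ 2)⁻¹) * X) * rescale ((q ^ 2)⁻¹) (gS F q) := by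
  ext i
  rw [sub_mul, one_mul, mul_assoc, mul_comm X]
  rcases i with _ | i
  · simp [gS, coeff_rescale, -coeff_zero_eq_constantCoeff, coeff_zero_mul_X, ← mul_assoc]
  · rw [map_sub]
    simp only [coeff_rescale, coeff_C_mul, coeff_succ_mul_X, gS, coeff_mk]
    obtain ⟨h1, h2, h3⟩ := qInt_ne F q hq hroot i
    have hf := qFact_ne F q hq hroot i
    rw [qFact_succ, Nat.choose_succ_succ' i 1, Nat.choose_one_right, pow_add q]
    have hp := pow_ne_zero i hq
    have hw := pow_ne_zero (i.choose 2) hq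
    set K := qInt F q ((i : ℤ) + 1)
    set A := qFact F q i
    rw [pow_succ q i] at h3
    have e1 : ((q ^ 2)⁻¹) ^ (i + 1) = ((q ^ i * q) ^ 2)⁻¹ := by
      rw [inv_pow]; congr 1; ring
    have e2 : ((q ^ 2)⁻¹) ^ i = ((q ^ i) ^ 2)⁻¹ := by
      rw [inv_pow]; congr 1; ring
    rw [e1, e2, pow_succ (-1 : F)]
    generalize q ^ i = u at *
    generalize q ^ (i.choose 2) = w at *
    generalize (-1 : F) ^ i = s at *
    field_simp at h3 ⊢
    linear_combination s * h3

theorem gS_mul_eS (hq : q ≠ 0) (hroot : ∀ n : ℕ, 0 < n → q ^ n ≠ 1) :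
    gS F q * eS F q = 1 := by
  have h : rescale ((q ^ 2)⁻¹) (gS F q * eS F q) = gS F q * eS F q := by
    rw [map_mul, eS_eq F q hq hroot]
    conv_rhs => rw [gS_eq F q hq hroot]
    ring
  ext i
  rcases i with _ | i
  · simp [coeff_mul, eS, gS, qFact]
  · have := congrArg (coeff (i + 1)) h
    rw [coeff_rescale] at this
    rw [coeff_one, if_neg (Nat.succ_ne_zero i)]
    by_contra h0
    have h1 := mul_right_cancel₀ h0 (this.trans (one_mul _).symm)
    rw [inv_pow, inv_eq_one, ← pow_mul] at h1
    exact hroot _ (by positivity) h1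

variable {F}

theorem aeval_trunc_coe {A : Type*} [Ring A] [Algebra F A] (n : A) (N : ℕ) (hN : n ^ N = 0)
    (p : Polynomial F) :
    Polynomial.aeval n (trunc N (p : PowerSeries F)) = Polynomial.aeval n p := by
  have : (Polynomial.X ^ N : Polynomial F) ∣ p - trunc N (p : PowerSeries F) := by
    rw [Polynomial.X_pow_dvd_iff]
    intro d hd
    simp [coeff_trunc, hd]
  obtain ⟨r, hr⟩ := this
  have h := congrArg (Polynomial.aeval n) hr
  rw [map_sub, map_mul, map_pow, Polynomial.aeval_X, hN, zero_mul] at h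
  exact (sub_eq_zero.mp h).symm

theorem aeval_trunc_mul {A : Type*} [Ring A] [Algebra F A] (n : A) (N : ℕ) (hN : n ^ N = 0)
    (f g : PowerSeries F) :
    Polynomial.aeval n (trunc N f) * Polynomial.aeval n (trunc N g) =
      Polynomial.aeval n (trunc N (f * g)) := by
  rw [← map_mul, ← aeval_trunc_coe n N hN, ← trunc_trunc_mul_trunc, Polynomial.coe_mul]

theorem aeval_trunc_sum {A : Type*} [Ring A] [Algebra F A] (n : A) (N : ℕ)
    (f : PowerSeries F) :
    Polynomial.aeval n (trunc N f) = ∑ i ∈ Finset.range N, coeff i f • n ^ i := by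
  rw [Polynomial.aeval_def, eval₂_trunc_eq_sum_range]
  simp only [Algebra.smul_def]

theorem pow_finrank_zero {V : Type*} [AddCommGroup V] [Module F V] [FiniteDimensional F V]
    (n : Module.End F V) (h : IsNilpotent n) : n ^ Module.finrank F V = 0 := by
  have h1 := LinearMap.aeval_self_charpoly n
  rwa [IsNilpotent.charpoly_eq_X_pow_finrank h, map_pow, Polynomial.aeval_X] at h1

end helpers

/-- exp_q(n_z)⁻¹ ∘ x ∘ exp_q(n_z) = x y x. -/
theorem stmt13 (hq : q ≠ 0) (hroot : ∀ n : ℕ, 0 < n → q ^ n ≠ 1)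
    (V : Type*) [AddCommGroup V] [Module F V] [FiniteDimensional F V] [Nontrivial V]
    (x y z : Module.End F V) (hy : IsUnit y)
    (hxy : q • (x * y) - q⁻¹ • (y * x) = (q - q⁻¹) • (1 : Module.End F V))
    (hyz : q • (y * z) - q⁻¹ • (z * y) = (q - q⁻¹) • (1 : Module.End F V))
    (hzx : q • (z * x) - q⁻¹ • (x * z) = (q - q⁻¹) • (1 : Module.End F V))
    (nz : Module.End F V) (hnz : nz = (q / (q - q⁻¹)) • (1 - x * y))
    (hnil : IsNilpotent nz) :
    expqInv F q nz * x * expq F q nz = x * y * x := by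
  obtain ⟨-, hd, -⟩ := qInt_ne F q hq hroot 0
  have hc : (1 : F) - (q ^ 2)⁻¹ = (q - q⁻¹) / q := by field_simp
  have hxy' : x * y = 1 - (1 - (q ^ 2)⁻¹) • nz := by
    rw [hnz, hc, smul_smul, div_mul_div_cancel₀ hq, div_self hd, one_smul, sub_sub_cancel]
  have hyx : y * x = q ^ 2 • (x * y) - (q ^ 2 - 1) • (1 : Module.End F V) := by
    have h := congrArg (fun t => q • t) hxy
    simp only [smul_sub, smul_smul, mul_inv_cancel₀ hq, one_smul, mul_sub] at h
    rw [pow_two, ← h, sub_sub_cancel]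
  have hcom : x * nz = (q ^ 2)⁻¹ • (nz * x) := by
    have h : nz * x = q ^ 2 • (x * nz) := by
      have h2 : x * (y * x) = q ^ 2 • (x * (x * y)) - (q ^ 2 - 1) • x := by
        rw [hyx, mul_sub, mul_smul_comm, mul_smul_comm, mul_one]
      rw [hnz, smul_mul_assoc, mul_smul_comm, smul_comm (q ^ 2), sub_mul, mul_sub, mul_assoc,
        h2, one_mul, mul_one]
      congr 1
      module
    rw [h, smul_smul, inv_mul_cancel₀ (pow_ne_zero _ hq), one_smul]
  have hcomi : ∀ i : ℕ, x * nz ^ i = ((q ^ 2)⁻¹) ^ i • (nz ^ i * x) := by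
    intro i
    induction i with
    | zero => simp
    | succ i ih =>
      rw [pow_succ, ← mul_assoc, ih, smul_mul_assoc, mul_assoc, hcom, mul_smul_comm, smul_smul,
        ← pow_succ, mul_assoc]
  have hN : nz ^ (Module.finrank F V + 1) = 0 := by
    rw [pow_succ, pow_finrank_zero nz hnil, zero_mul]
  have hE : expq F q nz = Polynomial.aeval nz (PowerSeries.trunc (Module.finrank F V + 1) (eS F q)) := by
    rw [aeval_trunc_sum]; simp [expq, eS]
  have hG : expqInv F q nz =
      Polynomial.aeval nz (PowerSeries.trunc (Module.finrank F V + 1) (gS F q)) := by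
    rw [aeval_trunc_sum]; simp [expqInv, gS]
  have hxE : x * expq F q nz = Polynomial.aeval nz (PowerSeries.trunc (Module.finrank F V + 1)
      (PowerSeries.rescale ((q ^ 2)⁻¹) (eS F q))) * x := by
    rw [aeval_trunc_sum, hE, aeval_trunc_sum, Finset.mul_sum, Finset.sum_mul]
    refine Finset.sum_congr rfl fun i _ => ?_
    rw [mul_smul_comm, hcomi, PowerSeries.coeff_rescale, smul_smul, smul_mul_assoc, mul_comm]
  have hpoly : (1 - PowerSeries.C (1 - (q ^ 2)⁻¹) * PowerSeries.X : PowerSeries F) =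
      ((1 - Polynomial.C (1 - (q ^ 2)⁻¹) * Polynomial.X : Polynomial F) : PowerSeries F) := by
    simp only [Polynomial.coe_sub, Polynomial.coe_mul, Polynomial.coe_one, Polynomial.coe_C,
      Polynomial.coe_X]
  rw [mul_assoc, hxE, hG, ← mul_assoc, aeval_trunc_mul nz _ hN, eS_eq F q hq hroot, ← mul_assoc,
    gS_mul_eS F q hq hroot, one_mul, hpoly, aeval_trunc_coe nz _ hN, hxy']
  congr 1
  rw [map_sub, map_mul, map_one, Polynomial.aeval_C, Polynomial.aeval_X, ← Algebra.smul_def]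

end Lusztig
end
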